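/- arXiv:2412.06291 — 4 statements merged into one kernel-verified Lean document; each statement's English description precedes it below -/
import Mathlib

section
/- Let N and p be positive integers with p ≥ 2 and p dividing N, let d ≥ 1, let K : ℝ^d → ℝ^d be any function, let x¹,…,x^N ∈ ℝ^d be fixed points, and let i ∈ {1,…,N} be a fixed index. Then the expectation, over a uniformly random batch partition 𝒞 of {1,…,N}, of (1/(p−1)) · Σ_{j ∈ 𝒞(i), j ≠ i} K(xʲ − xⁱ) equals (1/(N−1)) · Σ_{j ≠ i} K(xʲ − xⁱ). (Consistency/unbiasedness of the random batch approximation of the interaction force.) -/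
/-- A batch partition of `{1,…,N}` into blocks of size `p`, encoded via the map sending each
index to its block: every index lies in its own block, the blocks are the classes of an
equivalence (so they form a partition of `Fin N`), and every block has cardinality `p`.
Since the blocks all have size `p` and cover `Fin N`, there are `N / p` of them. -/
def IsBatchPartition (N p : ℕ) (B : Fin N → Finset (Fin N)) : Prop :=
  (∀ k, k ∈ B k) ∧ (∀ k l, k ∈ B l → B k = B l) ∧ (∀ k, (B k).card = p)

instance (N p : ℕ) : DecidablePred (IsBatchPartition N p) := fun _ => by
  unfold IsBatchPartition; infer_instance

open Finset

theorem IsBatchPartition.map {N p : ℕ} {B : Fin N → Finset (Fin N)} (hB : IsBatchPartition N p B)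
    (σ : Equiv.Perm (Fin N)) :
    IsBatchPartition N p fun a => (B (σ.symm a)).map σ.toEmbedding := by
  obtain ⟨h₁, h₂, h₃⟩ := hB
  refine ⟨fun k => ?_, fun k l hkl => ?_, fun k => ?_⟩
  · simpa [mem_map_equiv] using h₁ (σ.symm k)
  · rw [mem_map_equiv] at hkl
    simp only [h₂ _ _ hkl]
  · simpa using h₃ (σ.symm k)

theorem exists_isBatchPartition {N p : ℕ} (hpN : p ∣ N) :
    ∃ B : Fin N → Finset (Fin N), IsBatchPartition N p B := by
  obtain ⟨m, rfl⟩ := hpN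
  rw [mul_comm]
  refine ⟨fun k => univ.filter fun l => l.divNat = k.divNat, by simp, fun k l hkl => ?_,
    fun k => ?_⟩
  · simp only [mem_filter, mem_univ, true_and] at hkl
    simp only [hkl]
  · have h : (univ.filter fun l : Fin (m * p) => l.divNat = k.divNat) =
        (univ : Finset (Fin p)).map
          ((Function.Embedding.sectR k.divNat (Fin p)).trans finProdFinEquiv.toEmbedding) := by
      ext l
      simp only [mem_filter, mem_univ, true_and, mem_map, Function.Embedding.trans_apply,
        Function.Embedding.sectR_apply, Equiv.coe_toEmbedding]
      constructor
      · intro hl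
        exact ⟨l.modNat, by rw [← hl]; exact finProdFinEquiv.apply_symm_apply l⟩
      · rintro ⟨r, rfl⟩
        exact congrArg Prod.fst (finProdFinEquiv.symm_apply_apply (k.divNat, r))
    simp only [h, card_map, card_univ, Fintype.card_fin]

/-- The batch of `i` contains `j` for at most as many batch partitions as it contains `k`. -/
theorem card_isBatchPartition_mem_le {N p : ℕ} {i j k : Fin N} (hj : j ≠ i) (hk : k ≠ i) :
    #{B : {B : Fin N → Finset (Fin N) // IsBatchPartition N p B} | j ∈ B.1 i} ≤
      #{B : {B : Fin N → Finset (Fin N) // IsBatchPartition N p B} | k ∈ B.1 i} := by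
  refine card_le_card_of_injOn (fun B => ⟨_, B.2.map (Equiv.swap j k)⟩) ?_ ?_
  · intro B hB
    simpa [mem_map_equiv, Equiv.swap_apply_of_ne_of_ne hj.symm hk.symm] using hB
  · intro B _ C _ hBC
    refine Subtype.ext (funext fun a => ?_)
    have h := congrFun (congrArg Subtype.val hBC) (Equiv.swap j k a)
    simpa using h

theorem card_isBatchPartition_mem_mul {N p : ℕ} {i j : Fin N} (hj : j ≠ i) :
    #{B : {B : Fin N → Finset (Fin N) // IsBatchPartition N p B} | j ∈ B.1 i} * (N - 1) =
      Fintype.card {B : Fin N → Finset (Fin N) // IsBatchPartition N p B} * (p - 1) := by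
  have h := sum_card_bipartiteAbove_eq_sum_card_bipartiteBelow
    (s := (univ : Finset {B : Fin N → Finset (Fin N) // IsBatchPartition N p B}))
    (t := univ.erase i) (fun B k => k ∈ B.1 i)
  have hl : ∀ B ∈ (univ : Finset {B : Fin N → Finset (Fin N) // IsBatchPartition N p B}),
      #(bipartiteAbove (fun B k => k ∈ B.1 i) (univ.erase i) B) = p - 1 := by
    intro B _
    refine Eq.trans (congrArg card ?_)
      ((card_erase_of_mem (B.2.1 i)).trans (congrArg (· - 1) (B.2.2.2 i)))
    ext k
    simp [bipartiteAbove]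
  have hr : ∀ k ∈ univ.erase i,
      #(bipartiteBelow (fun (B : {B : Fin N → Finset (Fin N) // IsBatchPartition N p B}) k =>
        k ∈ B.1 i) univ k) =
      #{B : {B : Fin N → Finset (Fin N) // IsBatchPartition N p B} | j ∈ B.1 i} := by
    intro k hk
    have hk := ne_of_mem_erase hk
    exact (card_isBatchPartition_mem_le hk hj).antisymm (card_isBatchPartition_mem_le hj hk)
  rw [sum_congr rfl hl, sum_congr rfl hr] at h
  simpa [mul_comm, card_erase_of_mem] using h.symm


/-- Consistency (unbiasedness) of the random batch approximation: the expectation, over a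
uniformly random batch partition `B` of `{1,…,N}` into `N/p` blocks of size `p`, of
`(p-1)⁻¹ ∑_{j ∈ B(i), j ≠ i} K(xʲ - xⁱ)` equals `(N-1)⁻¹ ∑_{j ≠ i} K(xʲ - xⁱ)`. -/
theorem random_batch_unbiased (N p d : ℕ) (hp : 2 ≤ p) (hpN : p ∣ N) (hd : 1 ≤ d)
    (K : EuclideanSpace ℝ (Fin d) → EuclideanSpace ℝ (Fin d))
    (x : Fin N → EuclideanSpace ℝ (Fin d)) (i : Fin N) :
    (Fintype.card {B : Fin N → Finset (Fin N) // IsBatchPartition N p B} : ℝ)⁻¹ •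
      ∑ B : {B : Fin N → Finset (Fin N) // IsBatchPartition N p B},
        ((p : ℝ) - 1)⁻¹ • ∑ j ∈ (B.1 i).erase i, K (x j - x i) =
    ((N : ℝ) - 1)⁻¹ • ∑ j ∈ Finset.univ.erase i, K (x j - x i) := by
  have hN : 2 ≤ N := hp.trans (Nat.le_of_dvd i.pos hpN)
  obtain ⟨B₀, hB₀⟩ := exists_isBatchPartition hpN
  have : Nonempty {B : Fin N → Finset (Fin N) // IsBatchPartition N p B} := ⟨⟨B₀, hB₀⟩⟩
  have hM : (Fintype.card {B : Fin N → Finset (Fin N) // IsBatchPartition N p B} : ℝ) ≠ 0 :=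
    Nat.cast_ne_zero.2 Fintype.card_ne_zero
  have hp' : (p : ℝ) - 1 ≠ 0 := by
    have : (2 : ℝ) ≤ p := by exact_mod_cast hp
    linarith
  have hN' : (N : ℝ) - 1 ≠ 0 := by
    have : (2 : ℝ) ≤ N := by exact_mod_cast hN
    linarith
  have hB : ∀ B : {B : Fin N → Finset (Fin N) // IsBatchPartition N p B},
      ∑ j ∈ (B.1 i).erase i, K (x j - x i) =
        ∑ j ∈ univ.erase i, if j ∈ B.1 i then K (x j - x i) else 0 := by
    intro B
    rw [← sum_filter]
    refine sum_congr ?_ fun _ _ => rfl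
    ext k
    simp
  simp only [hB]
  rw [← smul_sum, sum_comm, smul_sum, smul_sum, smul_sum]
  refine sum_congr rfl fun j hj => ?_
  rw [← sum_filter, sum_const, ← Nat.cast_smul_eq_nsmul ℝ, smul_smul, smul_smul]
  congr 1
  have h := congrArg (Nat.cast : ℕ → ℝ)
    (card_isBatchPartition_mem_mul (p := p) (ne_of_mem_erase hj))
  rw [Nat.cast_mul, Nat.cast_mul, Nat.cast_pred (by omega), Nat.cast_pred (by omega)] at h
  field_simp
  linarith
end

section
/- Let N and p be positive integers with 2 ≤ p ≤ N, let d ≥ 1, and let K : ℝ^d → ℝ^d be L_K-Lipschitz. Then for any two families of points x¹,…,x^N ∈ ℝ^d and y¹,…,y^N ∈ ℝ^d, any subset C ⊆ {1,…,N} with |C| = p, and any index i ∈ C, the difference of batch fluctuation forces satisfies ‖[(1/(p−1)) Σ_{j ∈ C, j ≠ i} K(yʲ − yⁱ) − (1/(N−1)) Σ_{j ≠ i} K(yʲ − yⁱ)] − [(1/(p−1)) Σ_{j ∈ C, j ≠ i} K(xʲ − xⁱ) − (1/(N−1)) Σ_{j ≠ i} K(xʲ − xⁱ)]‖ ≤ 2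 L_K (‖yⁱ − xⁱ‖ + max_{1 ≤ j ≤ N} ‖yʲ − xʲ‖). -/
/-- The average of a family over `S \ {i}` is bounded in norm by any nonnegative uniform bound
on the terms. -/
lemma norm_smul_sum_erase_le {ι E : Type*} [DecidableEq ι] [SeminormedAddCommGroup E]
    [NormedSpace ℝ E] {S : Finset ι} {i : ι} (hi : i ∈ S) (f : ι → E) {B : ℝ}
    (hB : 0 ≤ B) (hf : ∀ j, ‖f j‖ ≤ B) :
    ‖((S.card : ℝ) - 1)⁻¹ • ∑ j ∈ S.erase i, f j‖ ≤ B := by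
  have hcard : ((S.erase i).card : ℝ) = (S.card : ℝ) - 1 := by
    rw [Finset.cast_card_erase_of_mem hi]
  have hsum : ‖∑ j ∈ S.erase i, f j‖ ≤ ((S.card : ℝ) - 1) * B := by
    rw [← hcard, ← nsmul_eq_mul]
    exact norm_sum_le_of_le _ (fun j _ => hf j) |>.trans_eq (Finset.sum_const B)
  have hnonneg : 0 ≤ (S.card : ℝ) - 1 := hcard ▸ Nat.cast_nonneg _
  rw [norm_smul, Real.norm_of_nonneg (inv_nonneg.mpr hnonneg)]
  exact inv_mul_le_of_le_mul₀ hnonneg hB hsum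


/-- Lipschitz continuity of the batch fluctuation force: if `K` is `L_K`-Lipschitz, then for
any batch `C ⊆ {1,…,N}` of size `p` containing `i` and any two families of points `x`, `y`,
the difference of the corresponding batch fluctuation forces is bounded by
`2 L_K (‖yⁱ - xⁱ‖ + max_j ‖yʲ - xʲ‖)`. -/
theorem batch_fluctuation_lipschitz (N p d : ℕ) (hp : 2 ≤ p) (hpN : p ≤ N) (hd : 1 ≤ d)
    (K : EuclideanSpace ℝ (Fin d) → EuclideanSpace ℝ (Fin d)) (LK : ℝ)
    (hK : ∀ a b, ‖K a - K b‖ ≤ LK * ‖a - b‖)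
    (x y : Fin N → EuclideanSpace ℝ (Fin d))
    (C : Finset (Fin N)) (hC : C.card = p) (i : Fin N) (hi : i ∈ C) :
    ‖(((p : ℝ) - 1)⁻¹ • ∑ j ∈ C.erase i, K (y j - y i) -
        ((N : ℝ) - 1)⁻¹ • ∑ j ∈ Finset.univ.erase i, K (y j - y i)) -
      (((p : ℝ) - 1)⁻¹ • ∑ j ∈ C.erase i, K (x j - x i) -
        ((N : ℝ) - 1)⁻¹ • ∑ j ∈ Finset.univ.erase i, K (x j - x i))‖ ≤
    2 * LK * (‖y i - x i‖ + ⨆ j : Fin N, ‖y j - x j‖) := by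
  have : Nonempty (Fin d) := ⟨⟨0, hd⟩⟩
  have hLK : 0 ≤ LK := by
    obtain ⟨a, b, hab⟩ := exists_pair_ne (EuclideanSpace ℝ (Fin d))
    exact nonneg_of_mul_nonneg_left ((norm_nonneg _).trans (hK a b))
      (norm_sub_pos_iff.mpr hab)
  set M := ⨆ j : Fin N, ‖y j - x j‖
  have hM (j : Fin N) : ‖y j - x j‖ ≤ M :=
    le_ciSup (f := fun j => ‖y j - x j‖) (Set.finite_range _).bddAbove j
  have hf (j : Fin N) : ‖K (y j - y i) - K (x j - x i)‖ ≤ LK * (‖y i - x i‖ + M) := by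
    refine (hK _ _).trans (mul_le_mul_of_nonneg_left ?_ hLK)
    rw [sub_sub_sub_comm, add_comm]
    exact (norm_sub_le _ _).trans (add_le_add_left (hM j) _)
  have hB := (norm_nonneg _).trans (hf i)
  have hbatch := norm_smul_sum_erase_le hi _ hB hf
  have hfull := norm_smul_sum_erase_le (Finset.mem_univ i) _ hB hf
  rw [hC, Finset.sum_sub_distrib, smul_sub] at hbatch
  rw [Finset.card_fin, Finset.sum_sub_distrib, smul_sub] at hfull
  rw [sub_sub_sub_comm, mul_assoc, two_mul]
  exact (norm_sub_le _ _).trans (add_le_add hbatch hfull)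
end

section
/- Let N ≥ 2, d ≥ 1, let V : ℝ^d → ℝ be differentiable with ⟨∇V(a) − ∇V(b), a − b⟩ ≥ λ_V ‖a − b‖² for all a, b ∈ ℝ^d (λ_V-strong convexity of V), and let K : ℝ^d → ℝ^d be L_K-Lipschitz. Then for any two families of points x¹,…,x^N ∈ ℝ^d and y¹,…,y^N ∈ ℝ^d, Σ_{i=1}^N ⟨yⁱ − xⁱ, −(∇V(yⁱ) − ∇V(xⁱ)) + (1/(N−1)) Σ_{j ≠ i} (K(yʲ − yⁱ) − K(xʲ − xⁱ))⟩ ≤ −(λ_V − 2 L_K) Σ_{i=1}^N ‖yⁱ − xⁱ‖². (Contraction estimate for the interacting drift.) -/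
open scoped RealInnerProductSpace

theorem nonneg_of_norm_sub_le_mul_norm_sub {E F : Type*} [NormedAddCommGroup E] [Nontrivial E]
    [SeminormedAddCommGroup F] {K : E → F} {L : ℝ} (hK : ∀ a b, ‖K a - K b‖ ≤ L * ‖a - b‖) : 0 ≤ L := by
  obtain ⟨a, b, hab⟩ := exists_pair_ne E
  exact nonneg_of_mul_nonneg_left ((norm_nonneg _).trans (hK a b))
    (norm_pos_iff.2 (sub_ne_zero.2 hab))

theorem inner_sub_lipschitz_sub_le {E : Type*} [NormedAddCommGroup E] [InnerProductSpace ℝ E]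
    {K : E → E} {L : ℝ} (hL : 0 ≤ L) (hK : ∀ a b, ‖K a - K b‖ ≤ L * ‖a - b‖)
    (x y x' y' : E) :
    ⟪y - x, K (y' - y) - K (x' - x)⟫ ≤
      L * (3 / 2 * ‖y - x‖ ^ 2 + 1 / 2 * ‖y' - x'‖ ^ 2) := by
  have htri : ‖(y' - y) - (x' - x)‖ ≤ ‖y' - x'‖ + ‖y - x‖ := by
    rw [sub_sub_sub_comm]
    exact norm_sub_le _ _
  calc ⟪y - x, K (y' - y) - K (x' - x)⟫
      ≤ ‖y - x‖ * ‖K (y' - y) - K (x' - x)‖ := real_inner_le_norm _ _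
    _ ≤ ‖y - x‖ * (L * (‖y' - x'‖ + ‖y - x‖)) := by
      gcongr
      exact (hK _ _).trans (by gcongr)
    _ = L * (‖y - x‖ * (‖y' - x'‖ + ‖y - x‖)) := by ring
    _ ≤ L * (3 / 2 * ‖y - x‖ ^ 2 + 1 / 2 * ‖y' - x'‖ ^ 2) := by
      gcongr
      nlinarith [sq_nonneg (‖y - x‖ - ‖y' - x'‖)]

theorem sum_sum_erase_eq {ι : Type*} [Fintype ι] [DecidableEq ι] (f : ι → ℝ) (a b : ℝ) :
    ∑ i, ∑ j ∈ Finset.univ.erase i, (a * f i + b * f j) =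
      ((Fintype.card ι : ℝ) - 1) * ((a + b) * ∑ i, f i) := by
  simp only [Finset.sum_erase_eq_sub (Finset.mem_univ _), Finset.sum_add_distrib,
    Finset.sum_sub_distrib, Finset.sum_const, Finset.card_univ, nsmul_eq_mul, ← Finset.mul_sum]
  ring

/-- Contraction estimate for the interacting drift: if `V` is differentiable and
`λ_V`-strongly convex (gradient monotonicity) and `K` is `L_K`-Lipschitz, then for any two
particle configurations `x`, `y`,
`∑ᵢ ⟨yⁱ - xⁱ, -(∇V(yⁱ) - ∇V(xⁱ)) + (N-1)⁻¹ ∑_{j ≠ i} (K(yʲ - yⁱ) - K(xʲ - xⁱ))⟩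
  ≤ -(λ_V - 2 L_K) ∑ᵢ ‖yⁱ - xⁱ‖²`. -/
theorem interacting_drift_contraction (N d : ℕ) (hN : 2 ≤ N) (hd : 1 ≤ d)
    (V : EuclideanSpace ℝ (Fin d) → ℝ) (gradV : EuclideanSpace ℝ (Fin d) → EuclideanSpace ℝ (Fin d))
    (hV : ∀ x, HasGradientAt V (gradV x) x)
    (lamV : ℝ) (hconv : ∀ a b, lamV * ‖a - b‖ ^ 2 ≤ ⟪gradV a - gradV b, a - b⟫)
    (K : EuclideanSpace ℝ (Fin d) → EuclideanSpace ℝ (Fin d)) (LK : ℝ)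
    (hK : ∀ a b, ‖K a - K b‖ ≤ LK * ‖a - b‖)
    (x y : Fin N → EuclideanSpace ℝ (Fin d)) :
    ∑ i : Fin N, ⟪y i - x i,
        -(gradV (y i) - gradV (x i)) +
          ((N : ℝ) - 1)⁻¹ • ∑ j ∈ Finset.univ.erase i, (K (y j - y i) - K (x j - x i))⟫ ≤
      -(lamV - 2 * LK) * ∑ i : Fin N, ‖y i - x i‖ ^ 2 := by
  have : Nonempty (Fin d) := ⟨⟨0, hd⟩⟩
  have hL : 0 ≤ LK := nonneg_of_norm_sub_le_mul_norm_sub hK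
  have hN' : (0 : ℝ) < (N : ℝ) - 1 := by
    have : (2 : ℝ) ≤ N := by exact_mod_cast hN
    linarith
  have hdrift : ∑ i, ⟪y i - x i, -(gradV (y i) - gradV (x i))⟫ ≤
      -lamV * ∑ i, ‖y i - x i‖ ^ 2 := by
    rw [Finset.mul_sum]
    refine Finset.sum_le_sum fun i _ => ?_
    rw [inner_neg_right, real_inner_comm, neg_mul]
    exact neg_le_neg (hconv _ _)
  have hinter : ∑ i, ∑ j ∈ Finset.univ.erase i,
      ⟪y i - x i, K (y j - y i) - K (x j - x i)⟫ ≤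
      ((N : ℝ) - 1) * (2 * LK * ∑ i, ‖y i - x i‖ ^ 2) := by
    calc _ ≤ ∑ i, ∑ j ∈ Finset.univ.erase i,
          LK * (3 / 2 * ‖y i - x i‖ ^ 2 + 1 / 2 * ‖y j - x j‖ ^ 2) :=
        Finset.sum_le_sum fun i _ => Finset.sum_le_sum fun j _ =>
          inner_sub_lipschitz_sub_le hL hK _ _ _ _
      _ = _ := by
        simp only [← Finset.mul_sum]
        rw [sum_sum_erase_eq (fun i => ‖y i - x i‖ ^ 2), Fintype.card_fin]
        ring
  simp only [inner_add_right, inner_smul_right, inner_sum, Finset.sum_add_distrib,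
    ← Finset.mul_sum]
  have hscaled := (inv_mul_le_iff₀ hN').2 hinter
  linarith
end

section
/- Let d ≥ 1, let V : ℝ^d → ℝ be differentiable with ∇V(0) = 0 and ⟨∇V(a) − ∇V(b), a − b⟩ ≥ λ_V ‖a − b‖² for all a, b ∈ ℝ^d (λ_V-strong convexity, λ_V > 0), let ε > 0, let M_K ≥ 0, and let u ∈ ℝ^d with ‖u‖ ≤ M_K. Then for every x ∈ ℝ^d, ⟨x/|x|_ε, −∇V(x) + u⟩ ≤ −λ_V |x|_ε + 2 λ_V ε + M_K, where |x|_ε := sqrt(‖x‖² + ε²). (Confinement estimate for the regularized norm.) -/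
open scoped RealInnerProductSpace

/-- Confinement estimate for the regularized norm: if `V` is differentiable, `λ_V`-strongly
convex with `∇V(0) = 0`, and `‖u‖ ≤ M_K`, then for every `x ∈ ℝ^d`,
`⟨x/|x|_ε, -∇V(x) + u⟩ ≤ -λ_V |x|_ε + 2 λ_V ε + M_K`, where `|x|_ε = sqrt(‖x‖² + ε²)`. -/
theorem regularized_confinement (d : ℕ) (hd : 1 ≤ d)
    (V : EuclideanSpace ℝ (Fin d) → ℝ)
    (gradV : EuclideanSpace ℝ (Fin d) → EuclideanSpace ℝ (Fin d))
    (hV : ∀ x, HasGradientAt V (gradV x) x) (hV0 : gradV 0 = 0)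
    (lamV : ℝ) (hlam : 0 < lamV)
    (hconv : ∀ a b, lamV * ‖a - b‖ ^ 2 ≤ ⟪gradV a - gradV b, a - b⟫)
    (ε : ℝ) (hε : 0 < ε) (MK : ℝ) (hMK : 0 ≤ MK)
    (u : EuclideanSpace ℝ (Fin d)) (hu : ‖u‖ ≤ MK)
    (x : EuclideanSpace ℝ (Fin d)) :
    ⟪(Real.sqrt (‖x‖ ^ 2 + ε ^ 2))⁻¹ • x, -gradV x + u⟫ ≤
      -lamV * Real.sqrt (‖x‖ ^ 2 + ε ^ 2) + 2 * lamV * ε + MK := by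
  set s := Real.sqrt (‖x‖ ^ 2 + ε ^ 2) with hs
  have hsq : s ^ 2 = ‖x‖ ^ 2 + ε ^ 2 := Real.sq_sqrt (by positivity)
  have hεs : ε ≤ s := Real.le_sqrt_of_sq_le (by nlinarith [sq_nonneg ‖x‖])
  have hxs : ‖x‖ ≤ s := Real.le_sqrt_of_sq_le (by nlinarith [sq_nonneg ε])
  have hspos : 0 < s := hε.trans_le hεs
  have hgrad : lamV * ‖x‖ ^ 2 ≤ ⟪x, gradV x⟫ := by
    simpa [hV0, real_inner_comm] using hconv x 0
  have hxu : ⟪x, u⟫ ≤ s * MK :=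
    (real_inner_le_norm x u).trans (mul_le_mul hxs hu (norm_nonneg u) hspos.le)
  have hlε : lamV * ε * ε ≤ lamV * ε * s := by gcongr
  have hlεs : 0 < lamV * ε * s := by positivity
  have hlsq : lamV * s ^ 2 = lamV * ‖x‖ ^ 2 + lamV * ε * ε := by rw [hsq]; ring
  rw [real_inner_smul_left, inner_add_right, inner_neg_right, inv_mul_le_iff₀ hspos]
  linarith
end
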